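/- Let φ : ℝ² → ℝ be a smooth compactly supported function with ∫_{ℝ²} φ = 0. If G(φ,φ) = −(1/2π)∫_{ℝ²}∫_{ℝ²} log‖x−y‖ φ(x)φ(y) dx dy = 0, then φ is identically zero. Hence G is positive definite on the space of mean-zero smooth compactly supported functions. -/

import Mathlib

open MeasureTheory

section Frullani

lemma norm_inv_mul_exp_sub_exp_le {a b t : ℝ} (hab : a ≤ b) (ht : 0 < t) :
    ‖t⁻¹ * (Real.exp (-(a * t)) - Real.exp (-(b * t)))‖ ≤ (b - a) * Real.exp (-(a * t)) := by
  have h1 : Real.exp (-(b * t)) = Real.exp (-(a * t)) * Real.exp (-((b - a) * t)) := by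
    rw [← Real.exp_add]
    ring_nf
  have h2 := Real.add_one_le_exp (-((b - a) * t))
  have h3 : Real.exp (-((b - a) * t)) ≤ 1 :=
    Real.exp_le_one_iff.2 (neg_nonpos.2 (mul_nonneg (sub_nonneg.2 hab) ht.le))
  have h4 := Real.exp_pos (-(a * t))
  rw [h1, ← mul_one_sub, Real.norm_of_nonneg
    (mul_nonneg (inv_nonneg.2 ht.le) (mul_nonneg h4.le (sub_nonneg.2 h3))), inv_mul_le_iff₀ ht]
  nlinarith

lemma integrableOn_inv_mul_exp_sub_exp {a b : ℝ} (ha : 0 < a) (hb : 0 < b) :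
    IntegrableOn (fun t : ℝ ↦ t⁻¹ * (Real.exp (-(a * t)) - Real.exp (-(b * t)))) (Set.Ioi 0) := by
  wlog hab : a ≤ b generalizing a b
  · refine (this hb ha (le_of_not_ge hab)).neg.congr (Filter.Eventually.of_forall fun t ↦ ?_)
    simp only [Pi.neg_apply]
    ring
  have hint : IntegrableOn (fun t : ℝ ↦ (b - a) * Real.exp (-(a * t))) (Set.Ioi 0) := by
    simp only [← neg_mul]
    exact (integrableOn_exp_mul_Ioi (neg_neg_of_pos ha) 0).const_mul (b - a)
  refine hint.mono' (by fun_prop) ?_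
  filter_upwards [ae_restrict_mem measurableSet_Ioi] with t ht
  exact norm_inv_mul_exp_sub_exp_le hab ht

lemma integral_inv_mul_exp_sub_exp {a b : ℝ} (ha : 0 < a) (hb : 0 < b) :
    ∫ t in Set.Ioi (0 : ℝ), t⁻¹ * (Real.exp (-(a * t)) - Real.exp (-(b * t))) =
      Real.log (b / a) := by
  have hc : Continuous fun t : ℝ ↦ Real.exp (-t) := by fun_prop
  have hL : Filter.Tendsto (fun t : ℝ ↦ Real.exp (-t)) (nhdsWithin 0 (Set.Ioi 0)) (nhds 1) := by
    simpa using (hc.tendsto 0).mono_left nhdsWithin_le_nhds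
  simpa using Frullani.integral_Ioi_eq (hc.locallyIntegrable.locallyIntegrableOn _) ha hb hL
    Real.tendsto_exp_neg_atTop_nhds_zero (by
      simpa only [smul_eq_mul] using integrableOn_inv_mul_exp_sub_exp ha hb)

lemma integral_norm_inv_mul_exp_sub_exp {a b : ℝ} (ha : 0 < a) (hb : 0 < b) :
    ∫ t in Set.Ioi (0 : ℝ), ‖t⁻¹ * (Real.exp (-(a * t)) - Real.exp (-(b * t)))‖ =
      |Real.log (b / a)| := by
  wlog hab : a ≤ b generalizing a b
  · have h := this hb ha (le_of_not_ge hab)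
    rw [← inv_div, Real.log_inv, abs_neg] at h
    rw [← h]
    congr 1 with t
    rw [← norm_neg]
    ring_nf
  rw [abs_of_nonneg (Real.log_nonneg ((one_le_div₀ ha).2 hab)),
    ← integral_inv_mul_exp_sub_exp ha hb]
  refine setIntegral_congr_fun measurableSet_Ioi fun t (ht : 0 < t) ↦ ?_
  refine Real.norm_of_nonneg (mul_nonneg (inv_nonneg.2 ht.le) (sub_nonneg.2 ?_))
  gcongr

end Frullani

section GaussianKernel

variable {V : Type*} [NormedAddCommGroup V] [InnerProductSpace ℝ V]

lemma exp_neg_norm_sub_sq_mul_exp_neg_norm_sub_sq (t : ℝ) (x y z : V) :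
    Real.exp (-(2 * t * ‖x - z‖ ^ 2)) * Real.exp (-(2 * t * ‖y - z‖ ^ 2)) =
      Real.exp (-(‖x - y‖ ^ 2 * t)) *
        Real.exp (-(4 * t * ‖z - (1 / 2 : ℝ) • (x + y)‖ ^ 2)) := by
  have h := parallelogram_law_with_norm ℝ (x - z) (y - z)
  have h1 : x - z + (y - z) = (-2 : ℝ) • (z - (1 / 2 : ℝ) • (x + y)) := by module
  have h2 : x - z - (y - z) = x - y := by abel
  rw [h1, h2, norm_smul, Real.norm_eq_abs, abs_neg, abs_two] at h
  rw [← Real.exp_add, ← Real.exp_add]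
  congr 1
  linear_combination t * h

variable [FiniteDimensional ℝ V] [MeasurableSpace V] [BorelSpace V]

lemma integrable_exp_neg_mul_norm_sub_sq {b : ℝ} (hb : 0 < b) (v : V) :
    Integrable fun z : V ↦ Real.exp (-(b * ‖z - v‖ ^ 2)) := by
  have h : Integrable fun z : V ↦ Real.exp (-(b * ‖z‖ ^ 2)) := by
    simp only [← neg_mul]
    refine Integrable.of_integral_ne_zero ?_
    rw [GaussianFourier.integral_rexp_neg_mul_sq_norm hb]
    positivity
  exact h.comp_sub_right v

lemma integral_exp_neg_norm_sub_sq_mul_exp_neg_norm_sub_sq (t : ℝ) (x y : V) :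
    ∫ z, Real.exp (-(2 * t * ‖x - z‖ ^ 2)) * Real.exp (-(2 * t * ‖y - z‖ ^ 2)) =
      Real.exp (-(‖x - y‖ ^ 2 * t)) * ∫ z : V, Real.exp (-(4 * t * ‖z‖ ^ 2)) := by
  simp_rw [exp_neg_norm_sub_sq_mul_exp_neg_norm_sub_sq, integral_const_mul]
  rw [integral_sub_right_eq_self (fun z : V ↦ Real.exp (-(4 * t * ‖z‖ ^ 2)))]

lemma integrable_exp_neg_norm_sub_sq_mul {φ : V → ℝ} (hφ : Integrable φ) {t : ℝ} (ht : 0 ≤ t) :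
    Integrable fun p : V × V ↦ Real.exp (-(‖p.1 - p.2‖ ^ 2 * t)) * (φ p.1 * φ p.2) := by
  refine (hφ.mul_prod hφ).bdd_mul (c := 1) (by fun_prop) (Filter.Eventually.of_forall fun p ↦ ?_)
  rw [Real.norm_eq_abs, Real.abs_exp, Real.exp_le_one_iff]
  have := mul_nonneg (sq_nonneg ‖p.1 - p.2‖) ht
  linarith

/-- The Gaussian kernel is positive semidefinite. -/
lemma integral_exp_neg_norm_sub_sq_mul_nonneg {φ : V → ℝ} (hφ : Integrable φ) {t : ℝ}
    (ht : 0 < t) :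
    0 ≤ ∫ p : V × V, Real.exp (-(‖p.1 - p.2‖ ^ 2 * t)) * (φ p.1 * φ p.2) := by
  set C := ∫ z : V, Real.exp (-(4 * t * ‖z‖ ^ 2)) with hC
  have hCpos : 0 < C := by
    simp only [hC, ← neg_mul (4 * t)]
    rw [GaussianFourier.integral_rexp_neg_mul_sq_norm (by positivity)]
    positivity
  let F : (V × V) → V → ℝ := fun p z ↦
    Real.exp (-(2 * t * ‖p.1 - z‖ ^ 2)) * Real.exp (-(2 * t * ‖p.2 - z‖ ^ 2)) * (φ p.1 * φ p.2)
  have hFz (p : V × V) : ∫ z, F p z = C * (Real.exp (-(‖p.1 - p.2‖ ^ 2 * t)) * (φ p.1 * φ p.2)) := by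
    simp only [F]
    rw [integral_mul_const, integral_exp_neg_norm_sub_sq_mul_exp_neg_norm_sub_sq]
    ring
  have hFp (z : V) : ∫ p, F p z = (∫ x, Real.exp (-(2 * t * ‖x - z‖ ^ 2)) * φ x) ^ 2 := by
    rw [sq, ← integral_prod_mul]
    refine integral_congr_ae (Filter.Eventually.of_forall fun p ↦ ?_)
    simp only [F]
    ring
  have hF : Integrable (Function.uncurry F) ((volume : Measure (V × V)).prod volume) := by
    have hm : AEStronglyMeasurable (Function.uncurry F) ((volume : Measure (V × V)).prod volume) := by
      refine AEStronglyMeasurable.mul (by fun_prop) ?_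
      exact (hφ.mul_prod hφ).aestronglyMeasurable.comp_fst
    rw [integrable_prod_iff hm]
    constructor
    · refine Filter.Eventually.of_forall fun p ↦ ?_
      simp only [Function.uncurry, F, exp_neg_norm_sub_sq_mul_exp_neg_norm_sub_sq]
      exact ((integrable_exp_neg_mul_norm_sub_sq (by positivity) _).const_mul _).mul_const _
    · refine ((integrable_exp_neg_norm_sub_sq_mul hφ ht.le).norm.const_mul C).congr
        (Filter.Eventually.of_forall fun p ↦ ?_)
      simp only [Function.uncurry, F, norm_mul, Real.norm_eq_abs, Real.abs_exp]
      rw [integral_mul_const, integral_exp_neg_norm_sub_sq_mul_exp_neg_norm_sub_sq]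
      ring
  have h := integral_integral_swap hF
  simp only [hFz, hFp, integral_const_mul] at h
  refine nonneg_of_mul_nonneg_right ?_ hCpos
  rw [h]
  exact integral_nonneg fun z ↦ sq_nonneg _

end GaussianKernel

section Plane

/-- The Euclidean plane. -/
abbrev Plane := EuclideanSpace ℝ (Fin 2)

lemma integrableOn_log_norm_ball (R : ℝ) :
    IntegrableOn (fun x : Plane ↦ Real.log ‖x‖) (Metric.ball 0 R) := by
  rw [integrableOn_fun_norm_addHaar volume (f := Real.log)]
  have h : Continuous fun y : ℝ ↦ y * Real.log y := Real.continuous_mul_log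
  refine IntegrableOn.mono_set (t := Set.Icc 0 R) ?_ Set.Ioo_subset_Icc_self
  simpa using h.continuousOn.integrableOn_compact isCompact_Icc

lemma integrable_log_norm_sub_mul {φ : Plane → ℝ} (hφ : Continuous φ) (hs : HasCompactSupport φ) :
    Integrable fun p : Plane × Plane ↦ Real.log ‖p.1 - p.2‖ * (φ p.1 * φ p.2) := by
  obtain ⟨M, hM⟩ := hs.exists_bound_of_continuous hφ
  obtain ⟨R, hR⟩ := hs.isCompact.isBounded.subset_ball 0
  let g : Plane → ℝ := (Metric.ball 0 (R + R)).indicator fun x ↦ Real.log ‖x‖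
  have hg : Integrable g :=
    (integrableOn_log_norm_ball (R + R)).integrable_indicator measurableSet_ball
  have h := (Integrable.convolution_integrand (μ := volume) (ν := volume)
    (ContinuousLinearMap.mul ℝ ℝ) (hφ.integrable_of_hasCompactSupport hs) hg).norm.const_mul M
  have hmφ := hφ.measurable
  refine h.mono' (by fun_prop) (Filter.Eventually.of_forall fun p ↦ ?_)
  have hM0 : 0 ≤ M := (norm_nonneg _).trans (hM 0)
  by_cases h1 : φ p.1 = 0
  · simp only [h1, zero_mul, mul_zero, norm_zero]
    positivity
  by_cases h2 : φ p.2 = 0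
  · simp only [h2, mul_zero, norm_zero]
    positivity
  have hb : p.1 - p.2 ∈ Metric.ball (0 : Plane) (R + R) := by
    have h1' := mem_ball_zero_iff.1 (hR (subset_tsupport φ h1))
    have h2' := mem_ball_zero_iff.1 (hR (subset_tsupport φ h2))
    rw [mem_ball_zero_iff]
    linarith [norm_sub_le p.1 p.2]
  simp only [ContinuousLinearMap.mul_apply', g, Set.indicator_of_mem hb, norm_mul]
  calc _ = ‖φ p.1‖ * (‖φ p.2‖ * ‖Real.log ‖p.1 - p.2‖‖) := by ring
    _ ≤ _ := by gcongr; exact hM _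

lemma ae_fst_ne_snd : ∀ᵐ p : Plane × Plane, p.1 ≠ p.2 := by
  have hm : MeasurableSet {p : Plane × Plane | p.1 ≠ p.2} :=
    (isOpen_ne_fun continuous_fst continuous_snd).measurableSet
  rw [Measure.volume_eq_prod, Measure.ae_prod_iff_ae_ae hm]
  refine Filter.Eventually.of_forall fun x ↦ ?_
  filter_upwards [compl_mem_ae_iff.2 (measure_singleton x)] with y hy
  exact fun h ↦ hy h.symm

/-- The double integral behind the representation of the logarithmic kernel as a superposition of
Gaussian kernels. -/
lemma integrable_inv_mul_exp_sub_exp_mul {φ : Plane → ℝ} (hφ : Continuous φ)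
    (hs : HasCompactSupport φ) :
    Integrable (Function.uncurry fun (p : Plane × Plane) (t : ℝ) ↦
      t⁻¹ * (Real.exp (-(‖p.1 - p.2‖ ^ 2 * t)) - Real.exp (-(1 * t))) * (φ p.1 * φ p.2))
      ((volume : Measure (Plane × Plane)).prod (volume.restrict (Set.Ioi 0))) := by
  have hmφ := hφ.measurable
  rw [integrable_prod_iff (by simp only [Function.uncurry_def]; fun_prop)]
  constructor
  · filter_upwards [ae_fst_ne_snd] with p hp
    have : 0 < ‖p.1 - p.2‖ := norm_sub_pos_iff.2 hp
    exact (integrableOn_inv_mul_exp_sub_exp (pow_pos this 2) one_pos).mul_const (φ p.1 * φ p.2)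
  · refine ((integrable_log_norm_sub_mul hφ hs).norm.const_mul 2).congr ?_
    filter_upwards [ae_fst_ne_snd] with p hp
    have : 0 < ‖p.1 - p.2‖ := norm_sub_pos_iff.2 hp
    simp only [Function.uncurry, norm_mul _ (φ p.1 * φ p.2)]
    rw [integral_mul_const, integral_norm_inv_mul_exp_sub_exp (pow_pos this 2) one_pos, one_div,
      Real.log_inv, abs_neg, Real.log_pow, abs_mul, Real.norm_eq_abs]
    push_cast
    rw [abs_two]
    ring

lemma integral_inv_mul_exp_sub_exp_mul {φ : Plane → ℝ} (hφ : Integrable φ) (hmean : ∫ y, φ y = 0)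
    {t : ℝ} (ht : 0 ≤ t) :
    ∫ p : Plane × Plane,
        t⁻¹ * (Real.exp (-(‖p.1 - p.2‖ ^ 2 * t)) - Real.exp (-(1 * t))) * (φ p.1 * φ p.2) =
      t⁻¹ * ∫ p : Plane × Plane, Real.exp (-(‖p.1 - p.2‖ ^ 2 * t)) * (φ p.1 * φ p.2) := by
  simp only [mul_assoc, sub_mul, integral_const_mul]
  rw [integral_sub (integrable_exp_neg_norm_sub_sq_mul hφ ht)
    ((hφ.mul_prod hφ).const_mul _), integral_const_mul, Measure.volume_eq_prod,
    integral_prod_mul, hmean]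
  ring

/-- For a mean-zero function, the logarithmic energy is a superposition of Gaussian energies. -/
lemma integral_log_norm_sub_mul {φ : Plane → ℝ} (hφ : Continuous φ) (hs : HasCompactSupport φ)
    (hmean : ∫ y, φ y = 0) :
    ∫ t in Set.Ioi (0 : ℝ),
        t⁻¹ * ∫ p : Plane × Plane, Real.exp (-(‖p.1 - p.2‖ ^ 2 * t)) * (φ p.1 * φ p.2) =
      -2 * ∫ p : Plane × Plane, Real.log ‖p.1 - p.2‖ * (φ p.1 * φ p.2) := by
  have h := integral_integral_swap (integrable_inv_mul_exp_sub_exp_mul hφ hs)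
  have hφi := hφ.integrable_of_hasCompactSupport hs (μ := volume)
  have hL : ∫ p : Plane × Plane, ∫ t in Set.Ioi (0 : ℝ),
      t⁻¹ * (Real.exp (-(‖p.1 - p.2‖ ^ 2 * t)) - Real.exp (-(1 * t))) * (φ p.1 * φ p.2) =
      ∫ p : Plane × Plane, -2 * (Real.log ‖p.1 - p.2‖ * (φ p.1 * φ p.2)) := by
    refine integral_congr_ae ?_
    filter_upwards [ae_fst_ne_snd] with p hp
    have : 0 < ‖p.1 - p.2‖ := norm_sub_pos_iff.2 hp
    rw [integral_mul_const, integral_inv_mul_exp_sub_exp (pow_pos this 2) one_pos, one_div,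
      Real.log_inv, Real.log_pow]
    push_cast
    ring
  rw [hL, integral_const_mul] at h
  rw [h]
  exact setIntegral_congr_fun measurableSet_Ioi fun t ht ↦
    (integral_inv_mul_exp_sub_exp_mul hφi hmean (le_of_lt ht)).symm

lemma tendsto_integral_gaussian_mul {φ : Plane → ℝ} (hφ : Continuous φ) (hφi : Integrable φ)
    (v : Plane) :
    Filter.Tendsto (fun c : ℝ ↦ ∫ w,
      Real.pi * c * Real.exp (-(‖v - w‖ ^ 2 * (Real.pi ^ 2 * c))) * φ w)
      Filter.atTop (nhds (φ v)) := by
  have h := Real.tendsto_integral_gaussian_smul' (f := fun w ↦ (φ w : ℂ)) hφi.ofReal (v := v)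
    (by fun_prop)
  have h2 := (Complex.continuous_re.tendsto _).comp h
  simp only [Complex.ofReal_re] at h2
  refine h2.congr fun c ↦ ?_
  simp only [Function.comp_apply]
  rw [← Complex.ofReal_re (∫ w, _), ← integral_complex_ofReal]
  congr 2 with w
  simp only [finrank_euclideanSpace_fin, smul_eq_mul]
  push_cast
  rw [div_self two_ne_zero, Complex.cpow_one]
  ring_nf

lemma abs_integral_gaussian_mul_le {φ : Plane → ℝ} {M : ℝ} (hM : ∀ x, ‖φ x‖ ≤ M) (v : Plane) {c : ℝ}
    (hc : 0 < c) :
    ‖∫ w, Real.pi * c * Real.exp (-(‖v - w‖ ^ 2 * (Real.pi ^ 2 * c))) * φ w‖ ≤ M := by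
  have hb : 0 < Real.pi ^ 2 * c := by positivity
  have hint := ((integrable_exp_neg_mul_norm_sub_sq hb v).const_mul (Real.pi * c)).mul_const M
  have hval : ∫ w : Plane, Real.pi * c * Real.exp (-(Real.pi ^ 2 * c * ‖w - v‖ ^ 2)) * M = M := by
    rw [integral_mul_const, integral_const_mul,
      integral_sub_right_eq_self (fun z : Plane ↦ Real.exp (-(Real.pi ^ 2 * c * ‖z‖ ^ 2)))]
    simp only [← neg_mul (Real.pi ^ 2 * c)]
    rw [GaussianFourier.integral_rexp_neg_mul_sq_norm hb, finrank_euclideanSpace_fin]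
    norm_num
    field_simp
  rw [← hval]
  refine norm_integral_le_of_norm_le hint (Filter.Eventually.of_forall fun w ↦ ?_)
  rw [norm_mul, Real.norm_of_nonneg (by positivity), norm_sub_rev, mul_comm (‖w - v‖ ^ 2)]
  gcongr
  exact hM w

lemma tendsto_gaussian_energy {φ : Plane → ℝ} (hφ : Continuous φ) (hs : HasCompactSupport φ) :
    Filter.Tendsto (fun c : ℝ ↦ Real.pi * c *
      ∫ p : Plane × Plane, Real.exp (-(‖p.1 - p.2‖ ^ 2 * (Real.pi ^ 2 * c))) * (φ p.1 * φ p.2))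
      Filter.atTop (nhds (∫ x, φ x * φ x)) := by
  obtain ⟨M, hM⟩ := hs.exists_bound_of_continuous hφ
  have hφi := hφ.integrable_of_hasCompactSupport hs (μ := volume)
  have hmφ := hφ.measurable
  have h : Filter.Tendsto (fun c : ℝ ↦ ∫ v, φ v * ∫ w,
      Real.pi * c * Real.exp (-(‖v - w‖ ^ 2 * (Real.pi ^ 2 * c))) * φ w)
      Filter.atTop (nhds (∫ x, φ x * φ x)) := by
    refine tendsto_integral_filter_of_dominated_convergence (fun v ↦ ‖φ v‖ * M)
      (Filter.Eventually.of_forall fun c ↦ ?_) ?_ (hφi.norm.mul_const M)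
      (Filter.Eventually.of_forall fun v ↦
        (tendsto_integral_gaussian_mul hφ hφi v).const_mul (φ v))
    · refine hφi.aestronglyMeasurable.mul (StronglyMeasurable.aestronglyMeasurable ?_)
      refine StronglyMeasurable.integral_prod_right' (f := fun p : Plane × Plane ↦
        Real.pi * c * Real.exp (-(‖p.1 - p.2‖ ^ 2 * (Real.pi ^ 2 * c))) * φ p.2) ?_
      exact Measurable.stronglyMeasurable (by fun_prop)
    · filter_upwards [Filter.eventually_gt_atTop 0] with c hc
      refine Filter.Eventually.of_forall fun v ↦ ?_
      rw [norm_mul]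
      gcongr
      exact abs_integral_gaussian_mul_le hM v hc
  refine h.congr' ?_
  filter_upwards [Filter.eventually_gt_atTop 0] with c hc
  have hE := integrable_exp_neg_norm_sub_sq_mul hφi (t := Real.pi ^ 2 * c) (by positivity)
  rw [Measure.volume_eq_prod, integral_prod _ hE, ← integral_const_mul]
  congr 1 with v
  rw [← integral_const_mul, ← integral_const_mul]
  congr 1 with w
  ring

/-- The logarithmic energy is definite on mean-zero functions. -/
lemma eq_zero_of_integral_log_norm_sub_mul_eq_zero {φ : Plane → ℝ} (hφ : Continuous φ)
    (hs : HasCompactSupport φ) (hmean : ∫ y, φ y = 0)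
    (hG : ∫ p : Plane × Plane, Real.log ‖p.1 - p.2‖ * (φ p.1 * φ p.2) = 0) : φ = 0 := by
  have hφi := hφ.integrable_of_hasCompactSupport hs (μ := volume)
  have hI := integral_log_norm_sub_mul hφ hs hmean
  rw [hG, mul_zero, setIntegral_eq_zero_iff_of_nonneg_ae] at hI
  rotate_left
  · filter_upwards [ae_restrict_mem measurableSet_Ioi] with t ht
    exact mul_nonneg (inv_nonneg.2 (le_of_lt ht))
      (integral_exp_neg_norm_sub_sq_mul_nonneg hφi ht)
  · refine (integrable_inv_mul_exp_sub_exp_mul hφ hs).integral_prod_right.congr ?_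
    filter_upwards [ae_restrict_mem measurableSet_Ioi] with t ht
    exact integral_inv_mul_exp_sub_exp_mul hφi hmean (le_of_lt ht)
  have hsq : ∫ x, φ x * φ x = 0 := by
    by_contra hne
    obtain ⟨N, hN⟩ := Filter.eventually_atTop.1
      ((tendsto_gaussian_energy hφ hs).eventually_ne hne)
    have hsub : Set.Ioi (Real.pi ^ 2 * max N 0) ⊆ Set.Ioi 0 :=
      Set.Ioi_subset_Ioi (by positivity)
    have hI' := ae_mono (Measure.restrict_mono_set volume hsub) hI
    have : (ae (volume.restrict (Set.Ioi (Real.pi ^ 2 * max N 0)))).NeBot := by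
      rw [ae_neBot, Ne, Measure.restrict_eq_zero]
      simp
    obtain ⟨t, ht0, ht⟩ := (Filter.Eventually.and hI' (ae_restrict_mem measurableSet_Ioi)).exists
    have ht' : 0 < t := hsub ht
    refine hN (t / Real.pi ^ 2) ?_ ?_
    · rw [le_div_iff₀ (by positivity), mul_comm]
      refine le_trans ?_ (le_of_lt ht)
      gcongr
      exact le_max_left _ _
    · rw [mul_div_cancel₀ t (by positivity)]
      simp only [Pi.zero_apply, mul_eq_zero, inv_eq_zero] at ht0
      rw [ht0.resolve_left ht'.ne', mul_zero]
  have hc : Continuous fun x ↦ φ x * φ x := hφ.mul hφ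
  rw [integral_eq_zero_iff_of_nonneg (fun x ↦ mul_self_nonneg _)
    (hc.integrable_of_hasCompactSupport hs.mul_left)] at hsq
  have := (hc.ae_eq_iff_eq volume continuous_zero).1 hsq
  ext x
  simpa using congrFun this x


end Plane

/-- Positive definiteness: if the Dirichlet energy of a mean-zero smooth compactly
supported function vanishes, the function is identically zero. -/
theorem stmt7 (φ : EuclideanSpace ℝ (Fin 2) → ℝ)
    (hφ : ContDiff ℝ (⊤ : ℕ∞) φ) (hs : HasCompactSupport φ)
    (hmean : ∫ y, φ y = 0)
    (hG : -(1 / (2 * Real.pi)) * ∫ x, ∫ y, Real.log ‖x - y‖ * φ x * φ y = 0) :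
    ∀ x, φ x = 0 := by
  have h : ∫ p : EuclideanSpace ℝ (Fin 2) × EuclideanSpace ℝ (Fin 2),
      Real.log ‖p.1 - p.2‖ * (φ p.1 * φ p.2) = 0 := by
    rw [Measure.volume_eq_prod, integral_prod _ (integrable_log_norm_sub_mul hφ.continuous hs)]
    simp only [← mul_assoc]
    refine (mul_eq_zero.1 hG).resolve_left ?_
    have := Real.pi_pos
    exact neg_ne_zero.2 (by positivity)
  exact congrFun (eq_zero_of_integral_log_norm_sub_mul_eq_zero hφ.continuous hs hmean h)
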